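/- Let p be an acceptance vector, let k ≥ 1 and d ≥ 0 be integers, and let T_d be the full k-ary token tree of depth d (every node at depth less than d has exactly k children, at indices 1, …, k). Then F(T_d) = Σ_{i=0}^{d} P_k^i, where P_k = Σ_{j=1}^{k} p_j. Consequently, if P_k < 1, then F(T_d) ≤ 1/(1 − P_k), uniformly in d; so the expected number of generated tokens for a full k-ary tree is bounded above by 1/(1 − P_k) regardless of the tree size. -/

import Mathlib

/-- A token tree: a finite rooted tree where the children of each node are
labeled by (positive-integer) indices. -/
inductive TokenTree : Type where
  | node : List (ℕ × TokenTree) → TokenTree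

namespace TokenTree

/-- The list of paths (lists of child indices) from the root to each node of the tree. -/
def paths : TokenTree → List (List ℕ)
  | .node cs => [] :: (cs.attach.flatMap (fun it => (paths it.1.2).map (fun l => it.1.1 :: l)))
decreasing_by
  obtain ⟨⟨a, b⟩, hmem⟩ := it
  have := List.sizeOf_lt_of_mem hmem
  simp at this ⊢
  omega

/-- The number of nodes of a token tree. -/
def size (T : TokenTree) : ℕ := T.paths.length

/-- The expected number of generated tokens: the sum over all nodes `v` of the
score `f(v) = ∏_{i ∈ Path(v)} p i`. -/
noncomputable def F (p : ℕ → ℝ) (T : TokenTree) : ℝ :=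
  (T.paths.map (fun l => (l.map p).prod)).sum

/-- The recursively defined expected number of generated tokens:
`D(T) = 1 + ∑_{i ∈ I} p i * D(T_i)`. -/
noncomputable def D (p : ℕ → ℝ) : TokenTree → ℝ
  | .node cs => 1 + (cs.attach.map (fun it => p it.1.1 * D p it.1.2)).sum
decreasing_by
  obtain ⟨⟨a, b⟩, hmem⟩ := it
  have := List.sizeOf_lt_of_mem hmem
  simp at this ⊢
  omega

/-- Well-formedness: child indices are positive and pairwise distinct at every node. -/
inductive WF : TokenTree → Prop
  | node (cs : List (ℕ × TokenTree))
      (hnodup : (cs.map Prod.fst).Nodup)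
      (hpos : ∀ it ∈ cs, 1 ≤ it.1)
      (hrec : ∀ it ∈ cs, WF it.2) : WF (.node cs)

end TokenTree

/-- An acceptance vector: nonnegative entries whose sum over any finite set of
(positive) child indices is at most 1. -/
def IsAcceptanceVector (p : ℕ → ℝ) : Prop :=
  (∀ i, 0 ≤ p i) ∧ ∀ I : Finset ℕ, (∀ i ∈ I, 1 ≤ i) → ∑ i ∈ I, p i ≤ 1

/-- The full `k`-ary token tree of depth `d`: every node at depth less than `d`
has exactly `k` children, at indices `1, …, k`. -/
def fullKaryTree (k : ℕ) : ℕ → TokenTree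
  | 0 => .node []
  | (d + 1) => .node ((List.range k).map (fun i => (i + 1, fullKaryTree k d)))

theorem F_node_aux (p : ℕ → ℝ) (cs : List (ℕ × TokenTree)) :
    TokenTree.F p (.node cs) = 1 + (cs.map (fun it => p it.1 * TokenTree.F p it.2)).sum := by
  have h : (TokenTree.node cs).paths =
      [] :: cs.flatMap (fun it => it.2.paths.map (fun l => it.1 :: l)) := by
    rw [TokenTree.paths]
    congr 1
    conv_rhs => rw [← List.attach_map_subtype_val cs]
    rw [List.flatMap_map]
  unfold TokenTree.F
  rw [h, List.map_cons, List.sum_cons]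
  congr 1
  clear h
  induction cs with
  | nil => simp
  | cons a t ih =>
    rw [List.flatMap_cons, List.map_append, List.sum_append, ih, List.map_cons, List.sum_cons]
    congr 1
    rw [List.map_map, ← List.sum_map_mul_left]
    simp [Function.comp_def]

theorem F_full_aux (p : ℕ → ℝ) (k d : ℕ) :
    TokenTree.F p (fullKaryTree k d)
      = ∑ i ∈ Finset.range (d + 1), (∑ j ∈ Finset.Icc 1 k, p j) ^ i := by
  induction d with
  | zero => simp [fullKaryTree, F_node_aux]
  | succ d ih =>
    have hP : ∑ j ∈ Finset.Icc 1 k, p j = ((List.range k).map (fun i => p (i + 1))).sum := by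
      clear ih
      induction k with
      | zero => simp
      | succ k ih => rw [Finset.sum_Icc_succ_top (by omega), ih, List.range_succ]; simp
    rw [Finset.sum_range_succ', fullKaryTree, F_node_aux, List.map_map]
    simp only [Function.comp_def, ih]
    rw [List.sum_map_mul_right, ← hP, Finset.mul_sum, pow_zero, add_comm]
    simp only [pow_succ']

/-- For the full `k`-ary token tree of depth `d`,
`F(T_d) = ∑_{i=0}^{d} P_k^i` where `P_k = ∑_{j=1}^{k} p_j`; consequently, if
`P_k < 1`, then `F(T_d) ≤ 1/(1 − P_k)`, uniformly in `d`. -/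
theorem full_kary_tree_bound
    (p : ℕ → ℝ) (hp : IsAcceptanceVector p)
    (k : ℕ) (hk : 1 ≤ k) (d : ℕ) :
    TokenTree.F p (fullKaryTree k d)
      = ∑ i ∈ Finset.range (d + 1), (∑ j ∈ Finset.Icc 1 k, p j) ^ i ∧
    ((∑ j ∈ Finset.Icc 1 k, p j) < 1 →
      TokenTree.F p (fullKaryTree k d) ≤ 1 / (1 - ∑ j ∈ Finset.Icc 1 k, p j)) := by
  refine ⟨F_full_aux p k d, fun h => ?_⟩
  have h0 : 0 ≤ ∑ j ∈ Finset.Icc 1 k, p j := Finset.sum_nonneg fun i _ => hp.1 i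
  rw [F_full_aux, le_div_iff₀ (by linarith), geom_sum_mul_neg]
  linarith [pow_nonneg h0 (d + 1)]
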